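/- Let ν > 0, let k₀ be the unique positive root of k tanh k = ν, and let k₁ < k₂ < ⋯ be the positive zeroes of the function k ↦ ν + k tan k. Then the system of functions ψ₀(y) = cosh(k₀(y + 1)), ψ_n(y) = cos(k_n(y + 1)) (n = 1, 2, …) is an orthogonal and complete system in L²(−1, 0); in particular, the closure of the linear span of {ψ_n : n ≥ 0} equals L²(−1, 0). -/

import Mathlib

open MeasureTheory Real Set

noncomputable section

/-- The open plane sector `F^(α) = {x ∈ ℝ² : x₂ > -|x₁| tan α}`
whose vertex angle is `π + 2α`. -/
def Fsec (α : ℝ) : Set (ℝ × ℝ) := {x : ℝ × ℝ | x.2 > -|x.1| * Real.tan α}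

/-- The sectorial water layer `W₁^(α) = F^(α) × (-1, 0)` of unit depth. -/
def W1 (α : ℝ) : Set ((ℝ × ℝ) × ℝ) := (Fsec α) ×ˢ Ioo (-1 : ℝ) 0

/-- The two-dimensional Laplacian of `w : ℝ × ℝ → ℝ`. -/
def lap2 (w : ℝ × ℝ → ℝ) (x : ℝ × ℝ) : ℝ :=
  deriv (deriv (fun t => w (t, x.2))) x.1 + deriv (deriv (fun t => w (x.1, t))) x.2

/-- The three-dimensional Laplacian of `φ : (ℝ × ℝ) × ℝ → ℝ`,
points being written `(x, y)` with `x ∈ ℝ²`, `y ∈ ℝ`. -/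
def lap3 (φ : (ℝ × ℝ) × ℝ → ℝ) (p : (ℝ × ℝ) × ℝ) : ℝ :=
  deriv (deriv (fun t => φ ((t, p.1.2), p.2))) p.1.1
    + deriv (deriv (fun t => φ ((p.1.1, t), p.2))) p.1.2
    + deriv (deriv (fun t => φ (p.1, t))) p.2

/-- The partial derivative `∂φ/∂y`. -/
def dY (φ : (ℝ × ℝ) × ℝ → ℝ) (p : (ℝ × ℝ) × ℝ) : ℝ :=
  deriv (fun t => φ (p.1, t)) p.2

/-- `|∇φ|²`, the squared euclidean norm of the three-dimensional gradient of `φ`. -/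
def gradSq (φ : (ℝ × ℝ) × ℝ → ℝ) (p : (ℝ × ℝ) × ℝ) : ℝ :=
  (deriv (fun t => φ ((t, p.1.2), p.2)) p.1.1) ^ 2
    + (deriv (fun t => φ ((p.1.1, t), p.2)) p.1.2) ^ 2
    + (deriv (fun t => φ (p.1, t)) p.2) ^ 2

open scoped BoundedContinuousFunction

local notation "μ₀" => (volume.restrict (Ioo (-1 : ℝ) 0) : Measure ℝ)

instance isProbabilityMeasure_restrict_Ioo_neg_one_zero : IsProbabilityMeasure μ₀ :=
  ⟨by simp⟩

theorem Lp_two_integrable (f : Lp ℝ 2 μ₀) : Integrable f μ₀ :=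
  (Lp.memLp f).integrable (by norm_num)

theorem Lp_two_integral_abs_le_norm (f : Lp ℝ 2 μ₀) : ∫ t, |f t| ∂μ₀ ≤ ‖f‖ := by
  have h := eLpNorm_le_eLpNorm_of_exponent_le (μ := μ₀) (p := 1) (q := 2) (f := f)
    (by norm_num) (Lp.aestronglyMeasurable f)
  have h' : ∫ t, |f t| ∂μ₀ = (eLpNorm f 1 μ₀).toReal := by
    rw [eLpNorm_one_eq_lintegral_enorm]
    exact integral_norm_eq_lintegral_enorm (Lp.aestronglyMeasurable f)
  rw [h', Lp.norm_def]
  exact ENNReal.toReal_mono (Lp.eLpNorm_ne_top f) h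

/-- The Green operator of `-u'' = f` on `(-1, 0)` with `u'(-1) = 0` and `u(0) = c u'(0)`. -/
def greenIntegral (c : ℝ) (f : ℝ → ℝ) (y : ℝ) : ℝ :=
  ∫ t in Ioo (-1 : ℝ) 0, (-max y t - c) * f t

section GreenIntegral

variable {c : ℝ} {f : ℝ → ℝ}

theorem integrable_greenIntegrand (c y : ℝ) (hf : Integrable f μ₀) :
    Integrable (fun t => (-max y t - c) * f t) μ₀ := by
  refine hf.bdd_mul (c := |y| + 1 + |c|) (by fun_prop) ?_
  filter_upwards [ae_restrict_mem measurableSet_Ioo] with t ht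
  rw [Real.norm_eq_abs, abs_le]
  rcases max_cases y t with ⟨h, _⟩ | ⟨h, _⟩ <;> rw [h] <;>
    constructor <;> linarith [ht.1, ht.2, neg_abs_le y, le_abs_self y, neg_abs_le c,
      le_abs_self c, abs_nonneg y]

theorem abs_greenIntegral_sub_le (hf : Integrable f μ₀) (x y : ℝ) :
    |greenIntegral c f x - greenIntegral c f y| ≤ |x - y| * ∫ t, |f t| ∂μ₀ := by
  unfold greenIntegral
  rw [← integral_sub (integrable_greenIntegrand c x hf) (integrable_greenIntegrand c y hf),
    ← integral_const_mul, ← Real.norm_eq_abs]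
  refine norm_integral_le_of_norm_le (hf.abs.const_mul _) (ae_of_all _ fun t => ?_)
  rw [← sub_mul, norm_mul, Real.norm_eq_abs, Real.norm_eq_abs]
  refine mul_le_mul_of_nonneg_right ?_ (abs_nonneg _)
  have := abs_max_sub_max_le_abs y x t
  rwa [abs_sub_comm y x, show max y t - max x t = -max x t - c - (-max y t - c) by ring] at this

theorem abs_greenIntegral_le (hf : Integrable f μ₀) {y : ℝ} (hy : y ∈ Icc (-1 : ℝ) 0) :
    |greenIntegral c f y| ≤ (1 + |c|) * ∫ t, |f t| ∂μ₀ := by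
  unfold greenIntegral
  rw [← integral_const_mul, ← Real.norm_eq_abs]
  refine norm_integral_le_of_norm_le (hf.abs.const_mul _) ?_
  filter_upwards [ae_restrict_mem measurableSet_Ioo] with t ht
  rw [norm_mul, Real.norm_eq_abs, Real.norm_eq_abs]
  gcongr
  rw [abs_le]
  rcases max_cases y t with ⟨h, _⟩ | ⟨h, _⟩ <;> rw [h] <;>
    constructor <;> linarith [ht.1, ht.2, hy.1, hy.2, neg_abs_le c, le_abs_self c]

theorem continuous_greenIntegral (hf : Integrable f μ₀) : Continuous (greenIntegral c f) := by
  refine (LipschitzWith.of_dist_le_mul (K := (∫ t, |f t| ∂μ₀).toNNReal) fun x y => ?_).continuous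
  rw [Real.coe_toNNReal _ (by positivity), mul_comm]
  exact abs_greenIntegral_sub_le hf x y

theorem greenIntegral_add {g : ℝ → ℝ} (hf : Integrable f μ₀) (hg : Integrable g μ₀) (y : ℝ) :
    greenIntegral c (f + g) y = greenIntegral c f y + greenIntegral c g y := by
  unfold greenIntegral
  rw [← integral_add (integrable_greenIntegrand c y hf) (integrable_greenIntegrand c y hg)]
  simp [mul_add]

theorem greenIntegral_smul (a : ℝ) (y : ℝ) :
    greenIntegral c (a • f) y = a * greenIntegral c f y := by
  unfold greenIntegral
  rw [← integral_const_mul]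
  congr 1 with t
  simp only [Pi.smul_apply, smul_eq_mul]
  ring

theorem greenIntegral_congr {g : ℝ → ℝ} (h : f =ᵐ[μ₀] g) :
    greenIntegral c f = greenIntegral c g := by
  ext y
  refine integral_congr_ae ?_
  filter_upwards [h] with t ht
  rw [ht]

theorem integral_greenIntegral_mul_comm {g : ℝ → ℝ} (hf : Integrable f μ₀)
    (hg : Integrable g μ₀) :
    ∫ y, greenIntegral c f y * g y ∂μ₀ = ∫ y, f y * greenIntegral c g y ∂μ₀ := by
  have hint : Integrable (Function.uncurry fun y t => (-max y t - c) * (g y * f t))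
      ((μ₀).prod μ₀) := by
    refine (hg.mul_prod hf).bdd_mul (c := 1 + |c|)
      (f := fun z : ℝ × ℝ => -max z.1 z.2 - c) (by fun_prop) ?_
    rw [Measure.prod_restrict]
    filter_upwards [ae_restrict_mem (measurableSet_Ioo.prod measurableSet_Ioo)] with z hz
    obtain ⟨⟨h1, h2⟩, h3, h4⟩ := hz
    rw [Real.norm_eq_abs, abs_le]
    rcases max_cases z.1 z.2 with ⟨h, _⟩ | ⟨h, _⟩ <;> rw [h] <;>
      constructor <;> linarith [neg_abs_le c, le_abs_self c]
  have hswap := integral_integral_swap hint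
  unfold greenIntegral
  calc _ = ∫ y, ∫ t, (-max y t - c) * (g y * f t) ∂μ₀ ∂μ₀ := by
        congr 1 with y
        rw [← integral_mul_const]
        congr 1 with t
        ring
    _ = _ := hswap
    _ = _ := by
        congr 1 with y
        rw [← integral_const_mul]
        congr 1 with t
        rw [max_comm]
        ring

theorem hasDerivAt_greenIntegral (hf : Integrable f μ₀) (y : ℝ) :
    HasDerivAt (greenIntegral c f) (-∫ t in Iio y, f t ∂μ₀) y := by
  have key := hasDerivAt_integral_of_dominated_loc_of_lip (μ := μ₀) (𝕜 := ℝ) (x₀ := y)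
    (F := fun x t => (-max x t - c) * f t) (F' := (Iio y).indicator fun t => -f t)
    (bound := f) (s := univ) Filter.univ_mem
    (Filter.Eventually.of_forall fun x => (integrable_greenIntegrand c x hf).aestronglyMeasurable)
    (integrable_greenIntegrand c y hf)
    (hf.neg.aestronglyMeasurable.indicator measurableSet_Iio)
    (ae_of_all _ fun t => ?_) hf ?_
  · have h := key.2
    rwa [integral_indicator measurableSet_Iio, integral_neg] at h
  · refine LipschitzOnWith.of_dist_le_mul fun x _ z _ => ?_
    rw [Real.dist_eq, Real.dist_eq, ← sub_mul, abs_mul, mul_comm, Real.coe_nnabs]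
    refine mul_le_mul_of_nonneg_left ?_ (abs_nonneg _)
    have := abs_max_sub_max_le_abs z x t
    rwa [abs_sub_comm z x, show max z t - max x t = -max x t - c - (-max z t - c) by ring] at this
  · have hne : ∀ᵐ t ∂μ₀, t ≠ y := ae_restrict_of_ae (Measure.ae_ne volume y)
    filter_upwards [hne] with t ht
    rcases lt_or_gt_of_ne ht with h | h
    · rw [indicator_of_mem (show t ∈ Iio y from h)]
      have h1 : HasDerivAt (fun x => (-x - c) * f t) (-f t) y := by
        simpa using (((hasDerivAt_id y).neg.sub_const c).mul_const (f t))
      refine h1.congr_of_eventuallyEq ?_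
      filter_upwards [Ioi_mem_nhds h] with x hx
      rw [max_eq_left (le_of_lt hx)]
    · rw [indicator_of_notMem (show t ∉ Iio y from not_lt.2 h.le)]
      refine (hasDerivAt_const y ((-t - c) * f t)).congr_of_eventuallyEq ?_
      filter_upwards [Iio_mem_nhds h] with x hx
      rw [max_eq_right (le_of_lt hx)]

theorem setIntegral_Iio_eq_intervalIntegral {y : ℝ} (hy : y ∈ Icc (-1 : ℝ) 0) :
    ∫ t in Iio y, f t ∂μ₀ = ∫ t in (-1 : ℝ)..y, f t := by
  rw [Measure.restrict_restrict measurableSet_Iio, intervalIntegral.integral_of_le hy.1,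
    integral_Ioc_eq_integral_Ioo]
  congr 2
  ext t
  simp only [mem_inter_iff, mem_Iio, mem_Ioo]
  constructor
  · rintro ⟨h1, h2, h3⟩; exact ⟨h2, h1⟩
  · rintro ⟨h1, h2⟩; exact ⟨h2, h1, h2.trans_le hy.2⟩

theorem ae_eq_zero_of_greenIntegral_ae_eq_zero (hf : Integrable f μ₀)
    (h : greenIntegral c f =ᵐ[μ₀] 0) : f =ᵐ[μ₀] 0 := by
  have hzero : EqOn (greenIntegral c f) 0 (Ioo (-1) 0) :=
    Measure.eqOn_open_of_ae_eq h isOpen_Ioo (continuous_greenIntegral hf).continuousOn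
      continuousOn_const
  have hprim : ∀ y ∈ Ioo (-1 : ℝ) 0, ∫ t in (-1 : ℝ)..y, f t = 0 := fun y hy => by
    have h1 := (hasDerivAt_greenIntegral (c := c) hf y)
    have h2 : HasDerivAt (greenIntegral c f) 0 y :=
      (hasDerivAt_const y (0 : ℝ)).congr_of_eventuallyEq
        (hzero.eventuallyEq_of_mem (isOpen_Ioo.mem_nhds hy))
    rw [← setIntegral_Iio_eq_intervalIntegral ⟨hy.1.le, hy.2.le⟩]
    linarith [h1.unique h2]
  have hint : IntervalIntegrable f volume (-1) 0 := by
    rw [intervalIntegrable_iff_integrableOn_Ioo_of_le (by norm_num)]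
    exact hf
  rw [Filter.EventuallyEq, ae_restrict_iff' measurableSet_Ioo]
  filter_upwards [hint.ae_hasDerivAt_integral] with y hy hmem
  have h1 := hy (by rw [uIcc_of_le (by norm_num)]; exact ⟨hmem.1.le, hmem.2.le⟩) (-1) (by simp)
  have h2 : HasDerivAt (fun x => ∫ t in (-1 : ℝ)..x, f t) 0 y := by
    refine (hasDerivAt_const y (0 : ℝ)).congr_of_eventuallyEq ?_
    filter_upwards [isOpen_Ioo.mem_nhds hmem] with x hx using hprim x hx
  exact h1.unique h2

end GreenIntegral

/-- `greenIntegral` as a linear map into the bounded continuous functions on `[-1, 0]`. -/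
def greenToBounded (c : ℝ) : Lp ℝ 2 μ₀ →ₗ[ℝ] (Icc (-1 : ℝ) 0 →ᵇ ℝ) where
  toFun f := BoundedContinuousFunction.mkOfCompact
    ⟨fun y => greenIntegral c f y,
      (continuous_greenIntegral (Lp_two_integrable f)).comp continuous_subtype_val⟩
  map_add' f g := by
    ext y
    simp only [BoundedContinuousFunction.mkOfCompact_apply, ContinuousMap.coe_mk,
      BoundedContinuousFunction.coe_add, Pi.add_apply]
    rw [greenIntegral_congr (Lp.coeFn_add f g),
      greenIntegral_add (Lp_two_integrable f) (Lp_two_integrable g)]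
  map_smul' a f := by
    ext y
    simp only [BoundedContinuousFunction.mkOfCompact_apply, ContinuousMap.coe_mk,
      BoundedContinuousFunction.coe_smul, RingHom.id_apply, smul_eq_mul]
    rw [greenIntegral_congr (Lp.coeFn_smul a f), greenIntegral_smul]

theorem isCompactOperator_greenToBounded (c : ℝ) : IsCompactOperator (greenToBounded c) := by
  rw [isCompactOperator_iff_image_ball_subset_compact _ one_pos]
  refine ⟨_, BoundedContinuousFunction.arzela_ascoli (Metric.closedBall 0 (1 + |c|))
    (isCompact_closedBall _ _) (greenToBounded c '' Metric.ball 0 1) ?_ ?_, subset_closure⟩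
  · rintro _ y ⟨f, hf, rfl⟩
    rw [mem_closedBall_zero_iff, Real.norm_eq_abs]
    refine (abs_greenIntegral_le (Lp_two_integrable f) y.2).trans ?_
    refine mul_le_of_le_one_right (by positivity) ?_
    exact (Lp_two_integral_abs_le_norm f).trans (mem_ball_zero_iff.1 hf).le
  · refine (LipschitzWith.uniformEquicontinuous _ 1 ?_).equicontinuous
    rintro ⟨_, f, hf, rfl⟩
    refine LipschitzWith.of_dist_le_mul fun x y => ?_
    rw [NNReal.coe_one, mul_comm, Subtype.dist_eq, Real.dist_eq, Real.dist_eq]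
    refine (abs_greenIntegral_sub_le (Lp_two_integrable f) x y).trans ?_
    gcongr
    exact (Lp_two_integral_abs_le_norm f).trans (mem_ball_zero_iff.1 hf).le

/-- The inclusion of the bounded continuous functions on `[-1, 0]` into `L²(-1, 0)`. -/
def boundedToLp : (Icc (-1 : ℝ) 0 →ᵇ ℝ) →L[ℝ] Lp ℝ 2 μ₀ :=
  (BoundedContinuousFunction.toLp 2 μ₀ ℝ).comp
    (BoundedContinuousFunction.compContinuousCLM ℝ ℝ
      ⟨projIcc (-1 : ℝ) 0 (by norm_num), continuous_projIcc⟩)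

theorem isCompactOperator_greenToLp (c : ℝ) :
    IsCompactOperator (boundedToLp.toLinearMap ∘ₗ greenToBounded c) :=
  (isCompactOperator_greenToBounded c).clm_comp boundedToLp

/-- The Green operator on `L²(-1, 0)`. -/
def greenOperator (c : ℝ) : Lp ℝ 2 μ₀ →L[ℝ] Lp ℝ 2 μ₀ :=
  ContinuousLinearMap.mkOfIsCompactOperator (isCompactOperator_greenToLp c)

theorem isCompactOperator_greenOperator (c : ℝ) : IsCompactOperator (greenOperator c) :=
  isCompactOperator_greenToLp c

theorem coeFn_greenOperator (c : ℝ) (f : Lp ℝ 2 μ₀) :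
    greenOperator c f =ᵐ[μ₀] greenIntegral c f := by
  have h := BoundedContinuousFunction.coeFn_toLp (p := 2) (μ := μ₀) (𝕜 := ℝ)
    ((greenToBounded c f).compContinuous ⟨projIcc (-1 : ℝ) 0 (by norm_num), continuous_projIcc⟩)
  filter_upwards [h, ae_restrict_mem measurableSet_Ioo] with y hy hmem
  refine hy.trans ?_
  change greenIntegral c f (projIcc (-1 : ℝ) 0 (by norm_num) y) = _
  rw [projIcc_of_mem _ ⟨hmem.1.le, hmem.2.le⟩]

theorem isSymmetric_greenOperator (c : ℝ) : (greenOperator c).IsSymmetric := by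
  intro f g
  change inner ℝ (greenOperator c f) g = inner ℝ f (greenOperator c g)
  rw [L2.inner_def, L2.inner_def]
  simp only [RCLike.inner_apply, conj_trivial]
  calc _ = ∫ y, greenIntegral c g y * f y ∂μ₀ := by
        rw [integral_greenIntegral_mul_comm (Lp_two_integrable g) (Lp_two_integrable f)]
        refine integral_congr_ae ?_
        filter_upwards [coeFn_greenOperator c f] with y hy
        rw [hy]
    _ = _ := by
        refine integral_congr_ae ?_
        filter_upwards [coeFn_greenOperator c g] with y hy
        rw [hy]

theorem eq_of_hasDerivAt_zero_Icc {a b : ℝ} {f : ℝ → ℝ}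
    (hf : ∀ y ∈ Icc a b, HasDerivAt f 0 y) : ∀ y ∈ Icc a b, f y = f a :=
  constant_of_has_deriv_right_zero (fun y hy => (hf y hy).continuousAt.continuousWithinAt)
    fun y hy => (hf y ⟨hy.1, hy.2.le⟩).hasDerivWithinAt

/-- `u` solves `-u'' = a u` on `[-1, 0]` with `u'(-1) = 0` and `u(0) = c u'(0)`, where `p = u'`. -/
structure IsRobinSolution (c a : ℝ) (u p : ℝ → ℝ) : Prop where
  hasDerivAt : ∀ y ∈ Icc (-1 : ℝ) 0, HasDerivAt u (p y) y
  hasDerivAt_deriv : ∀ y ∈ Icc (-1 : ℝ) 0, HasDerivAt p (-a * u y) y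
  deriv_left : p (-1) = 0
  right : u 0 = c * p 0

namespace IsRobinSolution

variable {c a : ℝ} {u p : ℝ → ℝ}

theorem integral_mul_eq_zero {b : ℝ} {v q : ℝ → ℝ} (hu : IsRobinSolution c a u p)
    (hv : IsRobinSolution c b v q) (hab : a ≠ b) :
    ∫ y in Ioo (-1 : ℝ) 0, u y * v y = 0 := by
  have hderiv : ∀ y ∈ uIcc (-1 : ℝ) 0,
      HasDerivAt (fun y => u y * q y - p y * v y) ((a - b) * (u y * v y)) y := fun y hy => by
    rw [uIcc_of_le (by norm_num)] at hy
    refine (((hu.hasDerivAt y hy).mul (hv.hasDerivAt_deriv y hy)).sub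
      ((hu.hasDerivAt_deriv y hy).mul (hv.hasDerivAt y hy))).congr_deriv ?_
    ring
  have hcont : ContinuousOn (fun y => (a - b) * (u y * v y)) (uIcc (-1 : ℝ) 0) := fun y hy => by
    rw [uIcc_of_le (by norm_num)] at hy
    exact (continuousAt_const.mul ((hu.hasDerivAt y hy).continuousAt.mul
      (hv.hasDerivAt y hy).continuousAt)).continuousWithinAt
  have h := intervalIntegral.integral_eq_sub_of_hasDerivAt hderiv hcont.intervalIntegrable
  rw [intervalIntegral.integral_const_mul, intervalIntegral.integral_of_le (by norm_num),
    integral_Ioc_eq_integral_Ioo, hu.deriv_left, hv.deriv_left, hu.right, hv.right] at h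
  refine (mul_eq_zero.1 (h.trans ?_)).resolve_left (sub_ne_zero.2 hab)
  ring

theorem cos {ν κ : ℝ} (hν : 0 < ν) (hκ : ν + κ * Real.tan κ = 0) :
    IsRobinSolution ν⁻¹ (κ ^ 2) (fun y => Real.cos (κ * (y + 1)))
      (fun y => -κ * Real.sin (κ * (y + 1))) where
  hasDerivAt y _ := by
    have := (((hasDerivAt_id y).add_const 1).const_mul κ).cos
    refine this.congr_deriv ?_
    simp only [id]; ring
  hasDerivAt_deriv y _ := by
    have := ((((hasDerivAt_id y).add_const 1).const_mul κ).sin).const_mul (-κ)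
    refine this.congr_deriv ?_
    simp only [id]; ring
  deriv_left := by simp
  right := by
    have hcos : Real.cos κ ≠ 0 := fun h => by
      rw [Real.tan_eq_sin_div_cos, h] at hκ
      simp at hκ
      exact hν.ne' hκ
    rw [Real.tan_eq_sin_div_cos] at hκ
    field_simp at hκ ⊢
    simp only [zero_add, mul_one]
    linarith

theorem cosh {ν κ : ℝ} (hν : 0 < ν) (hκ : κ * Real.tanh κ = ν) :
    IsRobinSolution ν⁻¹ (-κ ^ 2) (fun y => Real.cosh (κ * (y + 1)))
      (fun y => κ * Real.sinh (κ * (y + 1))) where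
  hasDerivAt y _ := by
    have := (((hasDerivAt_id y).add_const 1).const_mul κ).cosh
    refine this.congr_deriv ?_
    simp only [id]; ring
  hasDerivAt_deriv y _ := by
    have := ((((hasDerivAt_id y).add_const 1).const_mul κ).sinh).const_mul κ
    refine this.congr_deriv ?_
    simp only [id]; ring
  deriv_left := by simp
  right := by
    have hcosh := (Real.cosh_pos κ).ne'
    rw [Real.tanh_eq_sinh_div_cosh] at hκ
    field_simp at hκ ⊢
    simp only [zero_add, mul_one]
    linarith

theorem eq_cos {κ : ℝ} (hκ : κ ≠ 0) (hu : IsRobinSolution c (κ ^ 2) u p) {y : ℝ}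
    (hy : y ∈ Icc (-1 : ℝ) 0) :
    u y = u (-1) * Real.cos (κ * (y + 1)) ∧ p y = -κ * u (-1) * Real.sin (κ * (y + 1)) := by
  have hlin (y : ℝ) : HasDerivAt (fun y => κ * (y + 1)) κ y := by
    simpa using ((hasDerivAt_id y).add_const 1).const_mul κ
  have hA := eq_of_hasDerivAt_zero_Icc
    (f := fun y => p y * Real.cos (κ * (y + 1)) + κ * u y * Real.sin (κ * (y + 1)))
    (fun y hy => (((hu.hasDerivAt_deriv y hy).mul (hlin y).cos).add
      (((hu.hasDerivAt y hy).const_mul κ).mul (hlin y).sin)).congr_deriv (by ring)) y hy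
  have hB := eq_of_hasDerivAt_zero_Icc
    (f := fun y => κ * u y * Real.cos (κ * (y + 1)) - p y * Real.sin (κ * (y + 1)))
    (fun y hy => ((((hu.hasDerivAt y hy).const_mul κ).mul (hlin y).cos).sub
      ((hu.hasDerivAt_deriv y hy).mul (hlin y).sin)).congr_deriv (by ring)) y hy
  simp only [hu.deriv_left, neg_add_cancel, mul_zero, Real.cos_zero, Real.sin_zero, mul_one,
    add_zero, sub_zero] at hA hB
  have h1 := Real.sin_sq_add_cos_sq (κ * (y + 1))
  refine ⟨mul_left_cancel₀ hκ ?_, ?_⟩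
  · linear_combination Real.sin (κ * (y + 1)) * hA + Real.cos (κ * (y + 1)) * hB - κ * u y * h1
  · linear_combination Real.cos (κ * (y + 1)) * hA - Real.sin (κ * (y + 1)) * hB - p y * h1

theorem eq_cosh {κ : ℝ} (hκ : κ ≠ 0) (hu : IsRobinSolution c (-κ ^ 2) u p) {y : ℝ}
    (hy : y ∈ Icc (-1 : ℝ) 0) :
    u y = u (-1) * Real.cosh (κ * (y + 1)) ∧ p y = κ * u (-1) * Real.sinh (κ * (y + 1)) := by
  have hlin (y : ℝ) : HasDerivAt (fun y => κ * (y + 1)) κ y := by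
    simpa using ((hasDerivAt_id y).add_const 1).const_mul κ
  have hA := eq_of_hasDerivAt_zero_Icc
    (f := fun y => p y * Real.cosh (κ * (y + 1)) - κ * u y * Real.sinh (κ * (y + 1)))
    (fun y hy => (((hu.hasDerivAt_deriv y hy).mul (hlin y).cosh).sub
      (((hu.hasDerivAt y hy).const_mul κ).mul (hlin y).sinh)).congr_deriv (by ring)) y hy
  have hB := eq_of_hasDerivAt_zero_Icc
    (f := fun y => κ * u y * Real.cosh (κ * (y + 1)) - p y * Real.sinh (κ * (y + 1)))
    (fun y hy => ((((hu.hasDerivAt y hy).const_mul κ).mul (hlin y).cosh).sub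
      ((hu.hasDerivAt_deriv y hy).mul (hlin y).sinh)).congr_deriv (by ring)) y hy
  simp only [hu.deriv_left, neg_add_cancel, mul_zero, Real.cosh_zero, Real.sinh_zero, mul_one,
    sub_zero] at hA hB
  have h1 := Real.cosh_sq_sub_sinh_sq (κ * (y + 1))
  refine ⟨mul_left_cancel₀ hκ ?_, ?_⟩
  · linear_combination Real.sinh (κ * (y + 1)) * hA + Real.cosh (κ * (y + 1)) * hB - κ * u y * h1
  · linear_combination Real.cosh (κ * (y + 1)) * hA + Real.sinh (κ * (y + 1)) * hB - p y * h1

theorem tan_of_ne_zero {ν κ : ℝ} (hν : 0 < ν) (hκ : κ ≠ 0)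
    (hu : IsRobinSolution ν⁻¹ (κ ^ 2) u p) (h0 : u (-1) ≠ 0) : ν + κ * Real.tan κ = 0 := by
  obtain ⟨h1, h2⟩ := hu.eq_cos hκ (y := 0) (by norm_num)
  have h := hu.right
  rw [h1, h2, zero_add, mul_one] at h
  have hbc : ν * Real.cos κ + κ * Real.sin κ = 0 := by
    field_simp at h
    linear_combination h
  have hcos : Real.cos κ ≠ 0 := fun hc => by
    have hs : Real.sin κ = 0 := by simpa [hc, hκ] using hbc
    have := Real.sin_sq_add_cos_sq κ
    simp [hc, hs] at this
  rw [Real.tan_eq_sin_div_cos]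
  field_simp
  linarith

theorem tanh_of_ne_zero {ν κ : ℝ} (hν : 0 < ν) (hκ : κ ≠ 0)
    (hu : IsRobinSolution ν⁻¹ (-κ ^ 2) u p) (h0 : u (-1) ≠ 0) : κ * Real.tanh κ = ν := by
  obtain ⟨h1, h2⟩ := hu.eq_cosh hκ (y := 0) (by norm_num)
  have h := hu.right
  rw [h1, h2, zero_add, mul_one] at h
  have hcosh := (Real.cosh_pos κ).ne'
  rw [Real.tanh_eq_sinh_div_cosh]
  field_simp at h ⊢
  linarith

end IsRobinSolution

theorem exists_isRobinSolution_of_greenIntegral_ae_eq {c μ : ℝ} {f : ℝ → ℝ}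
    (hf : Integrable f μ₀) (hμ : μ ≠ 0) (h : ∀ᵐ y ∂μ₀, greenIntegral c f y = μ * f y) :
    ∃ u p : ℝ → ℝ, f =ᵐ[μ₀] u ∧ IsRobinSolution c μ⁻¹ u p := by
  set u : ℝ → ℝ := fun y => μ⁻¹ * greenIntegral c f y with hu
  have hfu : f =ᵐ[μ₀] u := by
    filter_upwards [h] with y hy
    simp only [hu]
    rw [hy, inv_mul_cancel_left₀ hμ]
  have hcont : Continuous u := continuous_const.mul (continuous_greenIntegral hf)
  have hIio : ∀ y ∈ Icc (-1 : ℝ) 0, ∫ t in Iio y, f t ∂μ₀ = ∫ t in (-1 : ℝ)..y, u t :=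
    fun y hy => by
      rw [← setIntegral_Iio_eq_intervalIntegral hy]
      exact integral_congr_ae (ae_restrict_of_ae hfu)
  refine ⟨u, fun y => -μ⁻¹ * ∫ t in (-1 : ℝ)..y, u t, hfu, ⟨fun y hy => ?_, fun y _ => ?_, ?_, ?_⟩⟩
  · refine ((hasDerivAt_greenIntegral hf y).const_mul μ⁻¹).congr_deriv ?_
    rw [hIio y hy]
    ring
  · exact (hcont.integral_hasStrictDerivAt (-1) y).hasDerivAt.const_mul (-μ⁻¹)
  · simp
  · have h0 : ∫ t in (-1 : ℝ)..0, u t = ∫ t, f t ∂μ₀ := by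
      rw [intervalIntegral.integral_of_le (by norm_num), integral_Ioc_eq_integral_Ioo]
      exact (integral_congr_ae hfu).symm
    have h1 : greenIntegral c f 0 = -c * ∫ t, f t ∂μ₀ := by
      rw [greenIntegral, ← integral_const_mul]
      refine integral_congr_ae ?_
      filter_upwards [ae_restrict_mem measurableSet_Ioo] with t ht
      rw [max_eq_left ht.2.le]
      ring
    rw [hu] at h0 ⊢
    simp only [h0, h1]
    ring

theorem mul_tanh_lt_mul_tanh {x y : ℝ} (hx : 0 < x) (hxy : x < y) :
    x * Real.tanh x < y * Real.tanh y := by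
  have h1 : 0 < Real.sinh (y - x) := Real.sinh_pos_iff.2 (sub_pos.2 hxy)
  have h2 : 0 < Real.sinh x := Real.sinh_pos_iff.2 hx
  have hcx := Real.cosh_pos x
  have hcy := Real.cosh_pos y
  rw [Real.sinh_sub] at h1
  rw [Real.tanh_eq_sinh_div_cosh, Real.tanh_eq_sinh_div_cosh, ← mul_div_assoc, ← mul_div_assoc,
    div_lt_div_iff₀ hcx hcy]
  nlinarith [mul_pos (sub_pos.2 hxy) (mul_pos h2 hcy), mul_pos (hx.trans hxy) h1]

theorem mem_span_of_ae_eq_smul {ψ : ℕ → ℝ → ℝ} {f : Lp ℝ 2 μ₀} {b : ℝ} (n : ℕ)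
    (h : ∀ᵐ y ∂μ₀, f y = b * ψ n y) :
    f ∈ Submodule.span ℝ {g : Lp ℝ 2 μ₀ | ∃ n : ℕ, (g : ℝ → ℝ) =ᵐ[μ₀] ψ n} := by
  rcases eq_or_ne b 0 with rfl | hb
  · have : f = 0 := by
      rw [Lp.eq_zero_iff_ae_eq_zero]
      filter_upwards [h] with y hy
      simp [hy]
    exact this ▸ Submodule.zero_mem _
  · have hmem : b⁻¹ • f ∈ {g : Lp ℝ 2 μ₀ | ∃ n : ℕ, (g : ℝ → ℝ) =ᵐ[μ₀] ψ n} := by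
      refine ⟨n, ?_⟩
      filter_upwards [h, Lp.coeFn_smul b⁻¹ f] with y hy hy'
      rw [hy', Pi.smul_apply, hy, smul_eq_mul, inv_mul_cancel_left₀ hb]
    simpa [smul_smul, hb] using Submodule.smul_mem _ b (Submodule.subset_span hmem)

/-- the system `ψ₀(y) = cosh(k₀(y+1))`, `ψₙ(y) = cos(kₙ(y+1))`
(`n ≥ 1`), where `k₀` is the positive root of `k tanh k = ν` and `k₁ < k₂ < ⋯` are
the positive zeroes of `k ↦ ν + k tan k`, is orthogonal and complete in `L²(-1,0)`:
the closure of its linear span is the whole space. -/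
theorem eigenfunction_system_orthogonal_and_complete (ν k₀ : ℝ) (hν : 0 < ν)
    (hk₀ : 0 < k₀) (hroot₀ : k₀ * Real.tanh k₀ = ν)
    (k : ℕ → ℝ)
    (hkpos : ∀ n, 1 ≤ n → 0 < k n)
    (hkroot : ∀ n, 1 ≤ n → ν + k n * Real.tan (k n) = 0)
    (hkmono : ∀ m n, 1 ≤ m → m < n → k m < k n)
    (hkall : ∀ x : ℝ, 0 < x → ν + x * Real.tan x = 0 → ∃ n, 1 ≤ n ∧ k n = x)
    (ψ : ℕ → ℝ → ℝ)
    (hψ0 : ∀ y, ψ 0 y = Real.cosh (k₀ * (y + 1)))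
    (hψn : ∀ n, 1 ≤ n → ∀ y, ψ n y = Real.cos (k n * (y + 1))) :
    (∀ m n : ℕ, m ≠ n → ∫ y in Ioo (-1 : ℝ) 0, ψ m y * ψ n y = 0) ∧
    (Submodule.span ℝ
        {g : Lp ℝ 2 (volume.restrict (Ioo (-1 : ℝ) 0)) |
          ∃ n : ℕ, (g : ℝ → ℝ) =ᵐ[volume.restrict (Ioo (-1 : ℝ) 0)] ψ n}).topologicalClosure
      = ⊤ := by
  have hroot_pos {x : ℝ} (hx : 0 < x) (hxν : x * Real.tanh x = ν) : x = k₀ := by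
    rcases lt_trichotomy x k₀ with h | h | h
    · linarith [mul_tanh_lt_mul_tanh hx h]
    · exact h
    · linarith [mul_tanh_lt_mul_tanh hk₀ h]
  have hψ0' : ψ 0 = fun y => Real.cosh (k₀ * (y + 1)) := funext hψ0
  have hψn' (n : ℕ) (hn : 1 ≤ n) : ψ n = fun y => Real.cos (k n * (y + 1)) := funext (hψn n hn)
  have hsol0 := IsRobinSolution.cosh hν hroot₀
  have hsoln (n : ℕ) (hn : 1 ≤ n) := IsRobinSolution.cos hν (hkroot n hn)
  refine ⟨?_, ?_⟩
  · have hlt (m n : ℕ) (hmn : m < n) : ∫ y in Ioo (-1 : ℝ) 0, ψ m y * ψ n y = 0 := by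
      have hn : 1 ≤ n := by omega
      have hkn := hkpos n hn
      rw [hψn' n hn]
      rcases Nat.eq_zero_or_pos m with rfl | hm
      · rw [hψ0']
        exact hsol0.integral_mul_eq_zero (hsoln n hn) (by nlinarith [sq_nonneg k₀])
      · rw [hψn' m hm]
        exact (hsoln m hm).integral_mul_eq_zero (hsoln n hn)
          (pow_lt_pow_left₀ (hkmono m n hm hmn) (hkpos m hm).le two_ne_zero).ne
    intro m n hmn
    rcases lt_or_gt_of_ne hmn with h | h
    · exact hlt m n h
    · simpa only [mul_comm] using hlt n m h
  · rw [Submodule.topologicalClosure_eq_top_iff, eq_bot_iff,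
      ← ContinuousLinearMap.orthogonalComplement_iSup_eigenspaces_eq_bot
        (isCompactOperator_greenOperator ν⁻¹) (isSymmetric_greenOperator ν⁻¹)]
    refine Submodule.orthogonal_le (iSup_le fun μ f hf => ?_)
    have hfint := Lp_two_integrable f
    have hf' : greenOperator ν⁻¹ f = μ • f := Module.End.mem_eigenspace_iff.1 hf
    have hae : ∀ᵐ y ∂(volume.restrict (Ioo (-1 : ℝ) 0)),
        greenIntegral ν⁻¹ f y = μ * f y := by
      filter_upwards [coeFn_greenOperator ν⁻¹ f, Lp.coeFn_smul μ f] with y h1 h2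
      rw [← h1, hf', h2, Pi.smul_apply, smul_eq_mul]
    rcases eq_or_ne μ 0 with rfl | hμ
    · have : f = 0 := by
        rw [Lp.eq_zero_iff_ae_eq_zero]
        refine ae_eq_zero_of_greenIntegral_ae_eq_zero (c := ν⁻¹) hfint ?_
        filter_upwards [hae] with y hy
        simp [hy]
      exact this ▸ Submodule.zero_mem _
    obtain ⟨u, p, hfu, hu⟩ := exists_isRobinSolution_of_greenIntegral_ae_eq hfint hμ hae
    rcases lt_or_gt_of_ne (inv_ne_zero hμ) with hneg | hpos
    · obtain ⟨κ, hκ, hκμ⟩ : ∃ κ : ℝ, 0 < κ ∧ μ⁻¹ = -κ ^ 2 :=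
        ⟨√(-μ⁻¹), Real.sqrt_pos.2 (neg_pos.2 hneg),
          by rw [Real.sq_sqrt (neg_pos.2 hneg).le, neg_neg]⟩
      rw [hκμ] at hu
      refine mem_span_of_ae_eq_smul (b := u (-1)) 0 ?_
      filter_upwards [hfu, ae_restrict_mem measurableSet_Ioo] with y hy hmem
      rw [hy, (hu.eq_cosh hκ.ne' ⟨hmem.1.le, hmem.2.le⟩).1, hψ0]
      rcases eq_or_ne (u (-1)) 0 with h0 | h0
      · simp [h0]
      · rw [hroot_pos hκ (hu.tanh_of_ne_zero hν hκ.ne' h0)]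
    · obtain ⟨κ, hκ, hκμ⟩ : ∃ κ : ℝ, 0 < κ ∧ μ⁻¹ = κ ^ 2 :=
        ⟨√μ⁻¹, Real.sqrt_pos.2 hpos, (Real.sq_sqrt hpos.le).symm⟩
      rw [hκμ] at hu
      obtain ⟨n, hn⟩ : ∃ n : ℕ, u (-1) ≠ 0 → 1 ≤ n ∧ k n = κ := by
        by_cases h0 : u (-1) = 0
        · exact ⟨0, fun h => absurd h0 h⟩
        · obtain ⟨n, hn⟩ := hkall κ hκ (hu.tan_of_ne_zero hν hκ.ne' h0)
          exact ⟨n, fun _ => hn⟩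
      refine mem_span_of_ae_eq_smul (b := u (-1)) n ?_
      filter_upwards [hfu, ae_restrict_mem measurableSet_Ioo] with y hy hmem
      rw [hy, (hu.eq_cos hκ.ne' ⟨hmem.1.le, hmem.2.le⟩).1]
      rcases eq_or_ne (u (-1)) 0 with h0 | h0
      · simp [h0]
      · rw [hψn n (hn h0).1, (hn h0).2]
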